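/- For every z = (z₁,…,z_k) ∈ ℂᵏ, the G-orbit G·z = {(g₁z₁,…,g_kz_k) : g ∈ G} is exactly the image of the map (μ_{s₁}×⋯×μ_{s_n}) × (ℂˣ)^{k−n} → ℂᵏ sending (w,λ) to the point whose j-th coordinate is (∏_{i=1}^n w_i^{P'_{i,j}}) · (∏_{l=1}^{k−n} λ_l^{P''_{l,j}}) · z_j. -/

import Mathlib

open scoped BigOperators

/-- The monomial map attached to an integer matrix: the `j`-th coordinate of the image of `g`
is the product of the `g i ^ M i j`. -/
def monomialMap {ι κ A : Type*} [Fintype ι] [CommGroup A] (M : Matrix ι κ ℤ) (g : ι → A) :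
    κ → A :=
  fun j => ∏ i, g i ^ M i j

theorem monomialMap_monomialMap {ι κ τ A : Type*} [Fintype ι] [Fintype κ] [CommGroup A]
    (M : Matrix ι κ ℤ) (N : Matrix κ τ ℤ) (g : ι → A) :
    monomialMap N (monomialMap M g) = monomialMap (M * N) g := by
  funext j
  have zpow_sum (a : A) (f : κ → ℤ) : a ^ ∑ l, f l = ∏ l, a ^ f l :=
    map_sum (zpowersHom A a).toAdditiveRight f Finset.univ
  simp only [monomialMap, Matrix.mul_apply, ← Finset.prod_zpow, ← zpow_mul, zpow_sum]
  exact Finset.prod_comm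

theorem monomialMap_one_matrix {ι A : Type*} [Fintype ι] [DecidableEq ι] [CommGroup A]
    (g : ι → A) : monomialMap (1 : Matrix ι ι ℤ) g = g := by
  funext j
  simp only [monomialMap]
  rw [Finset.prod_eq_single j] <;> simp +contextual

theorem monomialMap_one {ι κ A : Type*} [Fintype ι] [CommGroup A] (M : Matrix ι κ ℤ) :
    monomialMap M (1 : ι → A) = 1 := by
  funext j
  simp [monomialMap]

theorem monomialMap_eq_one_iff {ι A : Type*} [Fintype ι] [DecidableEq ι] [CommGroup A]
    {M : Matrix ι ι ℤ} (hM : IsUnit M.det) (g : ι → A) :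
    monomialMap M g = 1 ↔ g = 1 := by
  refine ⟨fun h => ?_, fun h => by rw [h, monomialMap_one]⟩
  rw [← monomialMap_one_matrix g, ← Matrix.mul_nonsing_inv M hM, ← monomialMap_monomialMap, h,
    monomialMap_one]

/-- If `P * N * Q` is diagonal with `Q` unimodular, then the monomial map of `N` kills
the image of `h` under that of `P` iff each `h i` is killed by the `i`-th diagonal entry. -/
theorem monomialMap_eq_one_iff_of_diagonal {n k : ℕ} {A : Type*} [CommGroup A] (hnk : n ≤ k)
    {N : Matrix (Fin k) (Fin n) ℤ} {P : Matrix (Fin k) (Fin k) ℤ}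
    {Q : Matrix (Fin n) (Fin n) ℤ} (hQ : IsUnit Q.det) {s : Fin n → ℤ}
    (hD : ∀ (i : Fin k) (j : Fin n),
      (P * N * Q) i j = if (i : ℕ) = (j : ℕ) then s j else 0) (h : Fin k → A) :
    monomialMap N (monomialMap P h) = 1 ↔ ∀ i, h (Fin.castLE hnk i) ^ s i = 1 := by
  rw [← monomialMap_eq_one_iff hQ, monomialMap_monomialMap, monomialMap_monomialMap, funext_iff,
    ← Matrix.mul_assoc]
  refine forall_congr' fun i => ?_
  have : monomialMap (P * N * Q) h i = h (Fin.castLE hnk i) ^ s i := by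
    simp only [monomialMap, hD]
    rw [Finset.prod_eq_single (Fin.castLE hnk i)]
    · simp
    · intro b _ hb
      rw [if_neg fun (hbi : (b : ℕ) = i) => hb (Fin.ext hbi), zpow_zero]
    · simp
  rw [this, Pi.one_apply]

/-- The splitting of `Fin k` into its first `n` and its last `k - n` elements. -/
def finSumSubEquiv {n k : ℕ} (hnk : n ≤ k) : Fin n ⊕ Fin (k - n) ≃ Fin k :=
  finSumFinEquiv.trans (finCongr (Nat.add_sub_cancel' hnk))

theorem finSumSubEquiv_inl {n k : ℕ} (hnk : n ≤ k) (i : Fin n) :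
    finSumSubEquiv hnk (Sum.inl i) = Fin.castLE hnk i := rfl

/-- Lemma 3.2 (orbit parametrization): for z ∈ ℂᵏ, the G-orbit G·z equals the image of
(μ_{s₁}×⋯×μ_{s_n}) × (ℂˣ)^{k−n}, (w,λ) ↦ ((∏ᵢ wᵢ^{P'_{i,j}})·(∏ₗ λₗ^{P''_{l,j}})·z_j)_j. -/
theorem stmt_1
    (n k : ℕ) (hn : 0 < n) (hnk : n ≤ k)
    (F : Matrix (Fin n) (Fin k) ℤ) (hF : F.rank = n)
    (P : Matrix (Fin k) (Fin k) ℤ) (hP : IsUnit P.det)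
    (Q : Matrix (Fin n) (Fin n) ℤ) (hQ : IsUnit Q.det)
    (s : Fin n → ℤ) (hs : ∀ i, s i ≠ 0)
    (hSNF : ∀ (i : Fin k) (j : Fin n),
      (P * F.transpose * Q) i j = if (i : ℕ) = (j : ℕ) then s j else 0)
    (P' : Matrix (Fin n) (Fin k) ℤ) (hP' : ∀ i j, P' i j = P (Fin.castLE hnk i) j)
    (P'' : Matrix (Fin (k - n)) (Fin k) ℤ)
    (hP'' : ∀ l j, P'' l j = P ⟨n + l.1, by have := l.2; omega⟩ j)
    (z : Fin k → ℂ) :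
    {x : Fin k → ℂ | ∃ g : Fin k → ℂˣ,
        (∀ i, ∏ j, g j ^ F i j = 1) ∧ ∀ j, x j = (g j : ℂ) * z j} =
    {x : Fin k → ℂ | ∃ (w : Fin n → ℂˣ) (lam : Fin (k - n) → ℂˣ),
        (∀ i, w i ^ s i = 1) ∧
        ∀ j, x j = (((∏ i, w i ^ P' i j) * ∏ l, lam l ^ P'' l j : ℂˣ) : ℂ) * z j} := by
  have split (h : Fin k → ℂˣ) (j : Fin k) : monomialMap P h j =
      (∏ i, h (finSumSubEquiv hnk (Sum.inl i)) ^ P' i j) *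
        ∏ l, h (finSumSubEquiv hnk (Sum.inr l)) ^ P'' l j := by
    simp only [monomialMap, hP', hP'']
    rw [← (finSumSubEquiv hnk).prod_comp, Fintype.prod_sum_type]
    rfl
  have mem (g : Fin k → ℂˣ) :
      (∀ i, ∏ j, g j ^ F i j = 1) ↔ monomialMap F.transpose g = 1 := funext_iff.symm
  ext x
  constructor
  · rintro ⟨g, hg, hx⟩
    obtain ⟨h, rfl⟩ : ∃ h, g = monomialMap P h :=
      ⟨monomialMap P⁻¹ g, by
        rw [monomialMap_monomialMap, Matrix.nonsing_inv_mul P hP, monomialMap_one_matrix]⟩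
    rw [mem, monomialMap_eq_one_iff_of_diagonal hnk hQ hSNF] at hg
    exact ⟨fun i => h (finSumSubEquiv hnk (Sum.inl i)),
      fun l => h (finSumSubEquiv hnk (Sum.inr l)), hg, fun j => by rw [hx, split]⟩
  · rintro ⟨w, lam, hw, hx⟩
    refine ⟨monomialMap P (Sum.elim w lam ∘ (finSumSubEquiv hnk).symm), ?_, fun j => ?_⟩
    · rw [mem, monomialMap_eq_one_iff_of_diagonal hnk hQ hSNF]
      intro i
      simpa [← finSumSubEquiv_inl] using hw i
    · rw [hx, split]
      simp
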